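/- Let X_1, …, X_n be independent standard Gaussian random variables and M_n = max_{1≤i≤n} |X_i|. Then, as n → ∞, √(log n) · ( E[M_n] − [ √(2·log(2n)) − (log(log(2n)) + log(4π) − 2γ)/(2·√(2·log(2n))) ] ) tends to 0, where γ is the Euler–Mascheroni constant; equivalently E[M_n] = √(2·log(2n)) − (log(log(2n)) + log(4π))/(2·√(2·log(2n))) + γ/√(2·log(2n)) + o((log n)^{-1/2}). -/

import Mathlib

open MeasureTheory ProbabilityTheory Filter

noncomputable section

/-- `E[max_{1 ≤ i ≤ n} |X_i|]` for `X_1, …, X_n` i.i.d. standard Gaussians: the `Pi` norm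
on `Fin n → ℝ` is the sup norm `max_i |x_i|`, and the law of the vector is the product of
`n` standard Gaussians. -/
def gaussMaxExp (n : ℕ) : ℝ :=
  ∫ x : Fin n → ℝ, ‖x‖ ∂(Measure.pi fun _ : Fin n => gaussianReal 0 1)


open Set Topology in
lemma layer {Ω : Type*} [MeasurableSpace Ω] {μ : Measure Ω} {f : Ω → ℝ} (hf : Integrable f μ) :
    ∫ x, f x ∂μ = (∫ s in Ioi (0:ℝ), μ.real {x | s < f x}) -
      ∫ s in Ioi (0:ℝ), μ.real {x | f x ≤ -s} := by
  have h1 : Integrable (fun x => max (f x) 0) μ := hf.pos_part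
  have h2 : Integrable (fun x => max (-f x) 0) μ := hf.neg_part
  have e : ∫ x, f x ∂μ = (∫ x, max (f x) 0 ∂μ) - ∫ x, max (-f x) 0 ∂μ := by
    rw [← integral_sub h1 h2]
    congr 1; ext x
    rcases le_total (f x) 0 with h | h
    · rw [max_eq_right h, max_eq_left (by linarith)]; ring
    · rw [max_eq_left h, max_eq_right (by linarith)]; ring
  rw [e, h1.integral_eq_integral_meas_lt (ae_of_all _ fun x => le_max_right _ _),
    h2.integral_eq_integral_meas_le (ae_of_all _ fun x => le_max_right _ _)]
  congr 1
  · refine setIntegral_congr_fun measurableSet_Ioi fun s hs => ?_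
    have hs : 0 < s := hs
    simp only [lt_max_iff, hs.not_gt, or_false]
  · refine setIntegral_congr_fun measurableSet_Ioi fun s hs => ?_
    have hs : 0 < s := hs
    simp only [le_max_iff, hs.not_ge, or_false, le_neg]

def nuE : Measure ℝ := (volume.restrict (Set.Ioi 0)).withDensity fun x => ENNReal.ofReal (Real.exp (-x))

lemma nuE_Ici {c : ℝ} (hc : 0 < c) : nuE (Set.Ici c) = ENNReal.ofReal (Real.exp (-c)) := by
  rw [nuE, withDensity_apply _ measurableSet_Ici, Measure.restrict_restrict measurableSet_Ici,
    Set.inter_eq_left.2 (show Set.Ici c ⊆ Set.Ioi 0 from fun x hx => lt_of_lt_of_le hc hx),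
    ← ofReal_integral_eq_lintegral_ofReal, integral_Ici_eq_integral_Ioi, integral_exp_neg_Ioi]
  · exact (integrableOn_Ici_iff_integrableOn_Ioi (by simp)).2 (integrableOn_exp_neg_Ioi c)
  · exact ae_of_all _ fun x => (Real.exp_pos _).le

instance : IsProbabilityMeasure nuE := by
  constructor
  rw [nuE, withDensity_apply _ MeasurableSet.univ, Measure.restrict_univ,
    ← ofReal_integral_eq_lintegral_ofReal, integral_exp_neg_Ioi]
  · simp
  · exact integrableOn_exp_neg_Ioi 0
  · exact ae_of_all _ fun x => (Real.exp_pos _).le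

lemma nuE_Iic : nuE (Set.Iic 0) = 0 := by
  rw [nuE, withDensity_apply _ measurableSet_Iic, Measure.restrict_restrict measurableSet_Iic,
    Set.Iic_inter_Ioi, Set.Ioc_self, Measure.restrict_empty, lintegral_zero_measure]

lemma nuE_real_Ici {c : ℝ} (hc : 0 < c) : nuE.real (Set.Ici c) = Real.exp (-c) := by
  rw [measureReal_def, nuE_Ici hc, ENNReal.toReal_ofReal (Real.exp_pos _).le]

lemma nuE_pos : ∀ᵐ x ∂nuE, 0 < x := by
  have := nuE_Iic
  rw [ae_iff]
  convert this using 2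
  ext x; simp

lemma gamma_int : ∫ t in Set.Ioi (0:ℝ), -Real.log t * Real.exp (-t) =
    Real.eulerMascheroniConstant := by
  have h1 := Complex.hasDerivAt_GammaIntegral (s := 1) (by simp)
  have h2 : HasDerivAt Complex.GammaIntegral (-(Real.eulerMascheroniConstant : ℂ)) 1 := by
    refine Complex.hasDerivAt_Gamma_one.congr_of_eventuallyEq ?_
    have : ∀ᶠ s : ℂ in nhds 1, 0 < s.re :=
      (Complex.continuous_re.tendsto 1).eventually (lt_mem_nhds (by simp))
    filter_upwards [this] with s hs
    exact (Complex.Gamma_eq_integral hs).symm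
  have h3 := h1.unique h2
  simp only [sub_self, Complex.cpow_zero, one_mul] at h3
  have h4 : (∫ t in Set.Ioi (0:ℝ), ((Real.log t : ℂ) * (Real.exp (-t) : ℂ))) =
      ((∫ t in Set.Ioi (0:ℝ), Real.log t * Real.exp (-t) : ℝ) : ℂ) := by
    rw [← integral_complex_ofReal]; simp
  rw [h4] at h3
  have h5 : (∫ t in Set.Ioi (0:ℝ), Real.log t * Real.exp (-t)) = -Real.eulerMascheroniConstant := by
    exact_mod_cast h3
  simp only [neg_mul]
  rw [integral_neg, h5, neg_neg]

lemma gamma_nuE : ∫ t, -Real.log t ∂nuE = Real.eulerMascheroniConstant := by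
  rw [nuE, integral_withDensity_eq_integral_toReal_smul (by fun_prop) (by simp), ← gamma_int]
  congr 1; ext t
  rw [ENNReal.toReal_ofReal (Real.exp_pos _).le, smul_eq_mul, mul_comm]

lemma integrable_nuE : Integrable (fun t => -Real.log t) nuE := by
  by_contra h
  have h1 := gamma_nuE
  rw [integral_undef h] at h1
  have := Real.one_half_lt_eulerMascheroniConstant
  linarith

lemma gamma_layer : (∫ s in Set.Ioi (0:ℝ), (1 - Real.exp (-Real.exp (-s)))) -
    (∫ s in Set.Ioi (0:ℝ), Real.exp (-Real.exp s)) = Real.eulerMascheroniConstant := by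
  rw [← gamma_nuE, layer integrable_nuE]
  congr 1
  · congr 1; ext s
    rw [← nuE_real_Ici (Real.exp_pos _), ← probReal_compl_eq_one_sub measurableSet_Ici]
    refine measureReal_congr ?_
    filter_upwards [nuE_pos] with x hx
    simp only [eq_iff_iff]
    change ¬ (Real.exp (-s) ≤ x) ↔ s < - Real.log x
    rw [not_le, ← Real.log_lt_iff_lt_exp hx]
    constructor <;> intro h <;> linarith
  · congr 1; ext s
    rw [← nuE_real_Ici (Real.exp_pos _)]
    refine measureReal_congr ?_
    filter_upwards [nuE_pos] with x hx
    simp only [eq_iff_iff]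
    change (Real.exp s ≤ x) ↔ - Real.log x ≤ -s
    rw [← Real.le_log_iff_exp_le hx]
    constructor <;> intro h <;> linarith

def phi (x : ℝ) : ℝ := (Real.sqrt (2 * Real.pi))⁻¹ * Real.exp (-x ^ 2 / 2)

lemma phi_eq : gaussianPDFReal 0 1 = phi := by
  ext x; simp [gaussianPDFReal, phi]

lemma phi_pos (x : ℝ) : 0 < phi x := by unfold phi; positivity

lemma phi_int : Integrable phi := by
  rw [← phi_eq]; exact integrable_gaussianPDFReal 0 1

lemma phi_deriv (x : ℝ) : HasDerivAt phi (-(x * phi x)) x := by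
  unfold phi
  have h : HasDerivAt (fun x : ℝ => -x ^ 2 / 2) (-x) x := by
    have := ((hasDerivAt_pow 2 x).neg).div_const 2
    refine this.congr_deriv ?_
    simp only [Nat.cast_ofNat, Nat.add_one_sub_one, pow_one]
    ring
  refine (h.exp.const_mul _).congr_deriv ?_
  ring

lemma phi_neg (x : ℝ) : phi (-x) = phi x := by simp [phi]

lemma phi_anti {x y : ℝ} (hx : 0 ≤ x) (h : x ≤ y) : phi y ≤ phi x := by
  unfold phi
  gcongr

lemma phi_tendsto : Tendsto phi atTop (nhds 0) := by
  unfold phi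
  rw [← mul_zero (Real.sqrt (2 * Real.pi))⁻¹]
  refine Tendsto.const_mul _ (Real.tendsto_exp_atBot.comp ?_)
  have : Tendsto (fun x : ℝ => x ^ 2 / 2) atTop atTop :=
    (tendsto_pow_atTop (by norm_num)).atTop_div_const (by norm_num)
  refine (tendsto_neg_atTop_atBot.comp this).congr fun x => ?_
  simp [neg_div]

def Q (t : ℝ) : ℝ := ∫ x in Set.Ioi t, phi x

lemma Q_nonneg (t : ℝ) : 0 ≤ Q t :=
  setIntegral_nonneg measurableSet_Ioi fun x _ => (phi_pos x).le

lemma Q_upper {t : ℝ} (ht : 0 < t) : Q t ≤ phi t / t := by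
  have hd : ∀ x ∈ Set.Ici t, HasDerivAt (fun x => -phi x) (x * phi x) x := fun x _ =>
    (phi_deriv x).neg.congr_deriv (by ring)
  have hp : ∀ x ∈ Set.Ioi t, 0 ≤ x * phi x := fun x hx =>
    mul_nonneg (ht.trans hx).le (phi_pos x).le
  have hl : Tendsto (fun x => -phi x) atTop (nhds 0) := by simpa using phi_tendsto.neg
  have hi := integrableOn_Ioi_deriv_of_nonneg' hd hp hl
  have he := integral_Ioi_of_hasDerivAt_of_nonneg' hd hp hl
  rw [le_div_iff₀ ht, Q, ← integral_mul_const]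
  have : ∫ x in Set.Ioi t, phi x * t ≤ ∫ x in Set.Ioi t, x * phi x := by
    refine setIntegral_mono_on (phi_int.integrableOn.mul_const t) hi measurableSet_Ioi
      fun x hx => ?_
    have hx : t < x := hx
    have := phi_pos x
    nlinarith
  linarith

lemma Q_lower {t : ℝ} (ht : 0 < t) : phi t / t ≤ (1 + 1 / t ^ 2) * Q t := by
  have hd : ∀ x ∈ Set.Ici t, HasDerivAt (fun x => -(phi x / x)) ((1 + 1 / x ^ 2) * phi x) x := by
    intro x hx
    have hx : 0 < x := lt_of_lt_of_le ht hx
    refine ((phi_deriv x).div (hasDerivAt_id x) hx.ne').neg.congr_deriv ?_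
    simp only [id]
    field_simp
    ring
  have hp : ∀ x ∈ Set.Ioi t, 0 ≤ (1 + 1 / x ^ 2) * phi x := fun x hx => by
    have := phi_pos x
    positivity
  have hl : Tendsto (fun x => -(phi x / x)) atTop (nhds 0) := by
    simpa using (phi_tendsto.div_atTop tendsto_id).neg
  have hi := integrableOn_Ioi_deriv_of_nonneg' hd hp hl
  have he := integral_Ioi_of_hasDerivAt_of_nonneg' hd hp hl
  rw [Q, ← integral_const_mul]
  have : ∫ x in Set.Ioi t, (1 + 1 / x ^ 2) * phi x ≤ ∫ x in Set.Ioi t, (1 + 1 / t ^ 2) * phi x := by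
    refine setIntegral_mono_on hi (phi_int.integrableOn.const_mul _) measurableSet_Ioi
      fun x hx => ?_
    have hx : t < x := hx
    have := phi_pos x
    gcongr
  linarith

lemma mills : Tendsto (fun t => Q t / (phi t / t)) atTop (nhds 1) := by
  have h : Tendsto (fun t : ℝ => (1 + 1 / t ^ 2)⁻¹) atTop (nhds 1) := by
    have : Tendsto (fun t : ℝ => 1 / t ^ 2) atTop (nhds 0) :=
      tendsto_const_nhds.div_atTop (tendsto_pow_atTop (by norm_num))
    simpa using ((this.const_add 1).inv₀ (by norm_num))
  refine tendsto_of_tendsto_of_tendsto_of_le_of_le' h tendsto_const_nhds ?_ ?_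
  · filter_upwards [eventually_gt_atTop 0] with t ht
    have hp := phi_pos t
    rw [inv_le_iff_one_le_mul₀' (by positivity), ← mul_div_assoc, le_div_iff₀ (by positivity),
      one_mul]
    exact Q_lower ht
  · filter_upwards [eventually_gt_atTop 0] with t ht
    have hp := phi_pos t
    rw [div_le_one (by positivity)]
    exact Q_upper ht

lemma Q_lower2 {u t : ℝ} (hu : 0 ≤ u) (h : u ≤ t) : (t - u) * phi t ≤ Q u := by
  have h1 : ∫ x in Set.Ioc u t, phi x ≤ Q u :=
    setIntegral_mono_set phi_int.integrableOn (ae_of_all _ fun x => (phi_pos x).le)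
      (Set.Ioc_subset_Ioi_self.eventuallyLE)
  refine le_trans ?_ h1
  have h2 : ∫ x in Set.Ioc u t, phi t ≤ ∫ x in Set.Ioc u t, phi x :=
    setIntegral_mono_on (by simp) phi_int.integrableOn measurableSet_Ioc
      fun x hx => phi_anti (hu.trans hx.1.le) hx.2
  simpa [h] using h2

lemma gauss_ball {t : ℝ} (ht : 0 ≤ t) :
    (gaussianReal 0 1).real (Metric.closedBall 0 t) = 1 - 2 * Q t := by
  have hc : (Metric.closedBall (0:ℝ) t)ᶜ = Set.Ioi t ∪ Set.Iio (-t) := by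
    ext x
    simp only [Set.mem_compl_iff, Metric.mem_closedBall, dist_zero_right, Real.norm_eq_abs, not_le,
      lt_abs, Set.mem_union, Set.mem_Ioi, Set.mem_Iio]
    constructor <;> rintro (h | h) <;> [left; right; left; right] <;> linarith
  have h := probReal_compl_eq_one_sub (μ := gaussianReal 0 1)
    (Metric.isClosed_closedBall (x := (0:ℝ)) (ε := t)).measurableSet
  have h2 : (gaussianReal 0 1).real (Metric.closedBall 0 t)ᶜ = 2 * Q t := by
    rw [measureReal_def, gaussianReal_apply_eq_integral _ (by norm_num), phi_eq,
      ENNReal.toReal_ofReal (integral_nonneg fun x => (phi_pos x).le), hc,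
      setIntegral_union _ measurableSet_Iio phi_int.integrableOn phi_int.integrableOn,
      ← integral_Iic_eq_integral_Iio]
    · have := integral_comp_neg_Ioi t phi
      simp only [phi_neg] at this
      rw [← this, Q]; ring
    · rw [Set.disjoint_left]
      intro x hx hx'
      simp only [Set.mem_Ioi, Set.mem_Iio] at hx hx'
      linarith
  linarith

lemma norm_le_prob (n : ℕ) {t : ℝ} (ht : 0 ≤ t) :
    (Measure.pi fun _ : Fin n => gaussianReal 0 1).real {x | ‖x‖ ≤ t} = (1 - 2 * Q t) ^ n := by
  have : {x : Fin n → ℝ | ‖x‖ ≤ t} = Metric.closedBall 0 t := by ext; simp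
  rw [this, measureReal_def, Measure.pi_closedBall _ _ ht, ENNReal.toReal_prod]
  have := gauss_ball ht
  rw [measureReal_def] at this
  simp [this]

lemma norm_integrable (n : ℕ) :
    Integrable (fun x : Fin n → ℝ => ‖x‖) (Measure.pi fun _ : Fin n => gaussianReal 0 1) := by
  have h : Integrable (fun x : Fin n → ℝ => ∑ i, ‖x i‖)
      (Measure.pi fun _ : Fin n => gaussianReal 0 1) := by
    refine integrable_finsetSum _ fun i _ => ?_
    have h0 : Integrable (fun x : ℝ => x) (gaussianReal 0 1) :=
      memLp_one_iff_integrable.1 (memLp_id_gaussianReal 1)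
    exact (measurePreserving_eval (fun _ : Fin n => gaussianReal 0 1) i).integrable_comp_of_integrable h0.norm
  refine h.mono (by fun_prop) (ae_of_all _ fun x => ?_)
  rw [norm_norm, Real.norm_of_nonneg (Finset.sum_nonneg fun i _ => norm_nonneg _)]
  refine (pi_norm_le_iff_of_nonneg (Finset.sum_nonneg fun i _ => norm_nonneg _)).2 fun i => ?_
  exact Finset.single_le_sum (f := fun i => ‖x i‖) (fun i _ => norm_nonneg _) (Finset.mem_univ i)
def cc (a : ℝ) : ℝ := Real.log a + Real.log (2 * Real.pi) / 2
def bb (a : ℝ) : ℝ := a - cc a / a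

lemma exp_cc {a : ℝ} (ha : 0 < a) : Real.exp (cc a) = a * Real.sqrt (2 * Real.pi) := by
  rw [cc, Real.exp_add, Real.exp_log ha, ← Real.log_sqrt (by positivity), Real.exp_log (by positivity)]

lemma K {a : ℝ} (ha : 0 < a) (s : ℝ) : Real.exp (a ^ 2 / 2) * phi (bb a + s / a) =
    a * Real.exp (-s) * Real.exp (-((s - cc a) / a) ^ 2 / 2) := by
  have h : Real.exp (a ^ 2 / 2) * Real.exp (-(bb a + s / a) ^ 2 / 2) =
      Real.exp (cc a) * Real.exp (-s) * Real.exp (-((s - cc a) / a) ^ 2 / 2) := by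
    rw [← Real.exp_add, ← Real.exp_add, ← Real.exp_add, bb]
    congr 1
    field_simp
    ring
  rw [phi, mul_left_comm, h, exp_cc ha]
  have : 0 < Real.sqrt (2 * Real.pi) := by positivity
  field_simp

lemma cc_div : Tendsto (fun a => cc a / a) atTop (nhds 0) := by
  have h1 : Tendsto (fun a : ℝ => Real.log a / a) atTop (nhds 0) :=
    Real.isLittleO_log_id_atTop.tendsto_div_nhds_zero
  have h2 : Tendsto (fun a : ℝ => Real.log (2 * Real.pi) / 2 / a) atTop (nhds 0) :=
    tendsto_const_nhds.div_atTop tendsto_id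
  have := h1.add h2
  rw [add_zero] at this
  exact this.congr fun a => by rw [cc, add_div]

lemma tt_tendsto (s : ℝ) : Tendsto (fun a => bb a + s / a) atTop atTop := by
  have h2 : Tendsto (fun a : ℝ => s / a) atTop (nhds 0) :=
    tendsto_const_nhds.div_atTop tendsto_id
  have : Tendsto (fun a => a + (s / a - cc a / a)) atTop atTop :=
    tendsto_id.atTop_add (h2.sub cc_div)
  exact this.congr fun a => by rw [bb]; ring

lemma tt_ratio (s : ℝ) : Tendsto (fun a => (bb a + s / a) / a) atTop (nhds 1) := by
  have h2 : Tendsto (fun a : ℝ => s / a / a) atTop (nhds 0) :=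
    (tendsto_const_nhds.div_atTop tendsto_id).div_atTop tendsto_id
  have h3 := ((cc_div.div_atTop tendsto_id).const_sub 1).add h2
  simp only [sub_zero, add_zero] at h3
  refine h3.congr' ?_
  filter_upwards [eventually_gt_atTop 0] with a ha
  rw [bb]; simp only [id]; field_simp

lemma ee_tendsto (s : ℝ) :
    Tendsto (fun a => Real.exp (-((s - cc a) / a) ^ 2 / 2)) atTop (nhds 1) := by
  have h2 : Tendsto (fun a : ℝ => s / a) atTop (nhds 0) :=
    tendsto_const_nhds.div_atTop tendsto_id
  have h3 := ((((h2.sub cc_div).pow 2).neg).div_const 2).rexp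
  simp only [sub_zero, ne_eq, OfNat.ofNat_ne_zero, not_false_eq_true, zero_pow, neg_zero, zero_div,
    Real.exp_zero] at h3
  exact h3.congr fun a => by rw [sub_div]

lemma scaledQ (s : ℝ) :
    Tendsto (fun a => Real.exp (a ^ 2 / 2) * Q (bb a + s / a)) atTop (nhds (Real.exp (-s))) := by
  have h := (((mills.comp (tt_tendsto s)).mul ((tt_ratio s).inv₀ one_ne_zero)).mul
    (ee_tendsto s)).mul_const (Real.exp (-s))
  simp only [inv_one, mul_one, one_mul] at h
  refine h.congr' ?_
  filter_upwards [eventually_gt_atTop 0, (tt_tendsto s).eventually_gt_atTop 0] with a ha ht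
  have hK := K ha s
  have hp := phi_pos (bb a + s / a)
  simp only [Function.comp]
  generalize bb a + s / a = t at *
  have : Real.exp (-((s - cc a) / a) ^ 2 / 2) * Real.exp (-s) = Real.exp (a ^ 2 / 2) * phi t / a := by
    rw [hK]; field_simp
  rw [mul_assoc, this]
  field_simp

def aa (n : ℕ) : ℝ := Real.sqrt (2 * Real.log (2 * n))

lemma aa_tendsto : Tendsto aa atTop atTop := by
  refine Real.tendsto_sqrt_atTop.comp (Tendsto.const_mul_atTop (by norm_num)
    (Real.tendsto_log_atTop.comp (Tendsto.const_mul_atTop (by norm_num)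
      tendsto_natCast_atTop_atTop)))

lemma aa_sq {n : ℕ} (hn : 1 ≤ n) : aa n ^ 2 = 2 * Real.log (2 * n) := by
  have : (1:ℝ) ≤ n := by exact_mod_cast hn
  rw [aa, Real.sq_sqrt]
  have := Real.log_nonneg (x := 2 * n) (by linarith)
  linarith

lemma exp_aa {n : ℕ} (hn : 1 ≤ n) : Real.exp (aa n ^ 2 / 2) = 2 * n := by
  have : (1:ℝ) ≤ n := by exact_mod_cast hn
  rw [aa_sq hn, mul_div_cancel_left₀ _ (by norm_num), Real.exp_log (by linarith)]

def pp (n : ℕ) (u : ℝ) : ℝ :=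
  (Measure.pi fun _ : Fin n => gaussianReal 0 1).real {x | ‖x‖ ≤ bb (aa n) + u / aa n}

lemma pp_eq {n : ℕ} {u : ℝ} (h : 0 ≤ bb (aa n) + u / aa n) :
    pp n u = (1 - 2 * Q (bb (aa n) + u / aa n)) ^ n := norm_le_prob n h

lemma pp_nonneg (n : ℕ) (u : ℝ) : 0 ≤ pp n u := measureReal_nonneg

lemma pp_le_one (n : ℕ) (u : ℝ) : pp n u ≤ 1 := measureReal_le_one

lemma pp_meas {n : ℕ} (h : 0 < aa n) : Measurable (pp n) := by
  refine Monotone.measurable fun u v huv => measureReal_mono fun x hx => ?_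
  have hx : ‖x‖ ≤ bb (aa n) + u / aa n := hx
  refine hx.trans ?_
  gcongr

lemma pp_tendsto (u : ℝ) :
    Tendsto (fun n => pp n u) atTop (nhds (Real.exp (-Real.exp (-u)))) := by
  have h : Tendsto (fun n : ℕ => (n : ℝ) * (-(2 * Q (bb (aa n) + u / aa n)))) atTop
      (nhds (-Real.exp (-u))) := by
    refine ((scaledQ u).comp aa_tendsto).neg.congr' ?_
    filter_upwards [eventually_ge_atTop 1] with n hn
    simp only [Function.comp]
    rw [exp_aa hn]; ring
  refine (Real.tendsto_one_add_pow_exp_of_tendsto h).congr' ?_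
  filter_upwards [((tt_tendsto u).comp aa_tendsto).eventually_ge_atTop 0] with n hn
  rw [pp_eq hn, sub_eq_add_neg]

lemma two_Q_le {t : ℝ} (ht : 0 ≤ t) : 2 * Q t ≤ 1 := by
  have := gauss_ball ht
  have h : 0 ≤ (gaussianReal 0 1).real (Metric.closedBall 0 t) := measureReal_nonneg
  linarith

lemma pp_upper {n : ℕ} (hn : 1 ≤ n) (ha : 0 < aa n) (hb : 1 / 2 < bb (aa n) / aa n) {s : ℝ}
    (hs : 0 < s) : 1 - pp n s ≤ 2 * Real.exp (-s) := by
  rw [lt_div_iff₀ ha] at hb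
  have hsa : 0 < s / aa n := by positivity
  have ht : 0 < bb (aa n) + s / aa n := by linarith
  have hK := K ha s
  have hQ := Q_upper ht
  have hE := exp_aa hn
  have h1 := one_add_mul_le_pow (a := -(2 * Q (bb (aa n) + s / aa n)))
    (by have := two_Q_le ht.le; linarith) n
  rw [pp_eq ht.le, sub_eq_add_neg 1 (2 * _)]
  have h2 : (2 * n) * Q (bb (aa n) + s / aa n) ≤ 2 * Real.exp (-s) := by
    rw [← hE]
    calc _ ≤ Real.exp (aa n ^ 2 / 2) * (phi (bb (aa n) + s / aa n) / (bb (aa n) + s / aa n)) := by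
            gcongr
      _ = aa n * Real.exp (-s) * Real.exp (-((s - cc (aa n)) / aa n) ^ 2 / 2)
            / (bb (aa n) + s / aa n) := by rw [← hK]; ring
      _ ≤ aa n * Real.exp (-s) * 1 / (aa n / 2) := by
            gcongr
            · rw [Real.exp_le_one_iff]
              have := sq_nonneg ((s - cc (aa n)) / aa n)
              linarith
            · linarith
      _ = _ := by field_simp
  linarith

lemma pp_lower {n : ℕ} (hn : 1 ≤ n) (ha : 0 < aa n)
    (he : 1 / 2 < Real.exp (-((0 - cc (aa n)) / aa n) ^ 2 / 2)) {s : ℝ}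
    (hs : 0 < s) : pp n (-s) ≤ Real.exp (-s / 2) := by
  by_cases ht : 0 ≤ bb (aa n) + (-s) / aa n
  · rw [pp_eq ht]
    have hsa : 0 < s / aa n := by positivity
    have h1 := Q_lower2 (t := bb (aa n)) ht (by rw [neg_div]; linarith)
    have hK := K ha 0
    have hE := exp_aa hn
    simp only [zero_div, add_zero, neg_zero, Real.exp_zero, mul_one, hE] at hK
    have h2 : s / 2 ≤ (2 * n) * Q (bb (aa n) + (-s) / aa n) := by
      calc s / 2 = s * (1 / 2) := by ring
        _ ≤ s * Real.exp (-((0 - cc (aa n)) / aa n) ^ 2 / 2) := by gcongr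
        _ = (s / aa n) * (2 * n * phi (bb (aa n))) := by rw [hK]; field_simp
        _ = (2 * n) * ((bb (aa n) - (bb (aa n) + (-s) / aa n)) * phi (bb (aa n))) := by ring
        _ ≤ _ := by gcongr
    have h3 := two_Q_le ht
    calc _ ≤ Real.exp (-(2 * Q (bb (aa n) + (-s) / aa n))) ^ n := by
            exact pow_le_pow_left₀ (by linarith) (Real.one_sub_le_exp_neg _) n
      _ = Real.exp (-((2 * n) * Q (bb (aa n) + (-s) / aa n))) := by
            rw [← Real.exp_nat_mul]; congr 1; ring
      _ ≤ _ := by rw [Real.exp_le_exp]; linarith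
  · have : pp n (-s) = 0 := by
      rw [pp]
      convert measureReal_empty
      ext x
      simp only [Set.mem_ofPred_eq, Set.mem_empty_iff_false, iff_false]
      intro hx
      exact ht ((norm_nonneg x).trans hx)
    rw [this]; positivity

lemma mean_eq {n : ℕ} (ha : 0 < aa n) : aa n * (gaussMaxExp n - bb (aa n)) =
    (∫ s in Set.Ioi (0:ℝ), (1 - pp n s)) - ∫ s in Set.Ioi (0:ℝ), pp n (-s) := by
  have hi := norm_integrable n
  have hf : Integrable (fun x : Fin n → ℝ => aa n * (‖x‖ - bb (aa n)))
      (Measure.pi fun _ : Fin n => gaussianReal 0 1) :=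
    (hi.sub (integrable_const _)).const_mul _
  have hl := layer hf
  rw [integral_const_mul, integral_sub hi (integrable_const _)] at hl
  simp only [integral_const, probReal_univ, one_smul] at hl
  rw [gaussMaxExp, hl]
  congr 1
  · congr 1; ext s
    rw [pp, ← probReal_compl_eq_one_sub (measurableSet_le (by fun_prop) (by fun_prop))]
    congr 1; ext x
    simp only [Set.mem_ofPred_eq, Set.mem_compl_iff, not_le]
    rw [← lt_sub_iff_add_lt', div_lt_iff₀ ha, mul_comm]
  · congr 1; ext s
    rw [pp]
    congr 1; ext x
    simp only [Set.mem_ofPred_eq]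
    rw [← sub_le_iff_le_add', le_div_iff₀ ha, mul_comm]

lemma mean_tendsto : Tendsto (fun n => aa n * (gaussMaxExp n - bb (aa n))) atTop
    (nhds Real.eulerMascheroniConstant) := by
  have ea : ∀ᶠ n in atTop, 0 < aa n := aa_tendsto.eventually_gt_atTop 0
  have eb : ∀ᶠ n in atTop, 1 / 2 < bb (aa n) / aa n := by
    have := ((tt_ratio 0).comp aa_tendsto).eventually (lt_mem_nhds (by norm_num : (1/2:ℝ) < 1))
    simpa using this
  have ee : ∀ᶠ n in atTop, 1 / 2 < Real.exp (-((0 - cc (aa n)) / aa n) ^ 2 / 2) :=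
    ((ee_tendsto 0).comp aa_tendsto).eventually (lt_mem_nhds (by norm_num : (1/2:ℝ) < 1))
  have e1 : ∀ᶠ n : ℕ in atTop, 1 ≤ n := eventually_ge_atTop 1
  rw [← gamma_layer]
  refine Tendsto.congr' (f₁ := fun n => (∫ s in Set.Ioi (0:ℝ), (1 - pp n s)) -
    ∫ s in Set.Ioi (0:ℝ), pp n (-s)) ?_ (Tendsto.sub ?_ ?_)
  · filter_upwards [ea] with n hn
    exact (mean_eq hn).symm
  · refine tendsto_integral_filter_of_dominated_convergence (fun s => 2 * Real.exp (-s)) ?_ ?_ ?_ ?_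
    · filter_upwards [ea] with n hn
      exact ((pp_meas hn).const_sub 1).aestronglyMeasurable
    · filter_upwards [ea, eb, e1] with n h1 h2 h3
      filter_upwards [ae_restrict_mem measurableSet_Ioi] with s hs
      rw [Real.norm_of_nonneg (by have := pp_le_one n s; linarith)]
      exact pp_upper h3 h1 h2 hs
    · exact (integrableOn_exp_neg_Ioi 0).const_mul 2
    · exact ae_of_all _ fun s => (pp_tendsto s).const_sub 1
  · refine tendsto_integral_filter_of_dominated_convergence (fun s => Real.exp (-s / 2)) ?_ ?_ ?_ ?_
    · filter_upwards [ea] with n hn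
      exact ((pp_meas hn).comp measurable_neg).aestronglyMeasurable
    · filter_upwards [ea, ee, e1] with n h1 h2 h3
      filter_upwards [ae_restrict_mem measurableSet_Ioi] with s hs
      rw [Real.norm_of_nonneg (pp_nonneg _ _)]
      exact pp_lower h3 h1 h2 hs
    · have := integrableOn_exp_mul_Ioi (a := -1/2) (by norm_num) 0
      refine this.congr (ae_of_all _ fun s => ?_)
      simp only []; congr 1; ring
    · refine ae_of_all _ fun s => ?_
      have := pp_tendsto (-s)
      rwa [neg_neg] at this

/-- `E[M_n] = √(2 log(2n)) − (log log(2n) + log(4π))/(2√(2 log(2n))) + γ/√(2 log(2n))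
      + o((log n)^{-1/2})`, where `γ` is the Euler–Mascheroni constant. -/
theorem stmt10 :
    Tendsto (fun n : ℕ => Real.sqrt (Real.log n) *
      (gaussMaxExp n -
        (Real.sqrt (2 * Real.log (2 * n)) -
          (Real.log (Real.log (2 * n)) + Real.log (4 * Real.pi) -
              2 * Real.eulerMascheroniConstant) /
            (2 * Real.sqrt (2 * Real.log (2 * n))))))
      atTop (nhds 0) := by
  have h0 := mean_tendsto.sub_const Real.eulerMascheroniConstant
  rw [sub_self] at h0
  have h1 : Tendsto (fun n : ℕ => (Real.sqrt (Real.log n) / aa n) *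
      (aa n * (gaussMaxExp n - bb (aa n)) - Real.eulerMascheroniConstant)) atTop (nhds 0) := by
    refine squeeze_zero_norm' ?_ (tendsto_zero_iff_norm_tendsto_zero.1 h0)
    filter_upwards [eventually_ge_atTop 1, aa_tendsto.eventually_gt_atTop 0] with n hn ha
    have hn' : (1:ℝ) ≤ n := by exact_mod_cast hn
    rw [norm_mul]
    refine mul_le_of_le_one_left (norm_nonneg _) ?_
    rw [Real.norm_of_nonneg (by positivity), div_le_one ha, aa]
    refine Real.sqrt_le_sqrt ?_
    have h2 : Real.log n ≤ Real.log (2 * n) := Real.log_le_log (by linarith) (by linarith)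
    have h3 := Real.log_nonneg hn'
    linarith
  refine h1.congr' ?_
  filter_upwards [eventually_ge_atTop 1, aa_tendsto.eventually_gt_atTop 0] with n hn ha
  have hsq := aa_sq hn
  have hL : Real.log (2 * n) = aa n ^ 2 / 2 := by linarith
  have hc : Real.log (Real.log (2 * n)) + Real.log (4 * Real.pi) = 2 * cc (aa n) := by
    rw [hL, cc, ← Real.log_mul (by positivity) (by positivity),
      show aa n ^ 2 / 2 * (4 * Real.pi) = aa n ^ 2 * (2 * Real.pi) by ring,
      Real.log_mul (by positivity) (by positivity), Real.log_pow]
    push_cast; ring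
  rw [hc]
  change _ = Real.sqrt (Real.log n) * (gaussMaxExp n - (aa n -
    (2 * cc (aa n) - 2 * Real.eulerMascheroniConstant) / (2 * aa n)))
  rw [bb]
  field_simp
  ring
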